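/- Fix an integer n ≥ 1. For each m, consider elections with candidate set {1,…,m} in which each of n voters casts a ranking (a linear order on the candidates), each candidate receives Borda score m−p from a vote that places it in position p (positions 1,…,m, position 1 most preferred), and the winner is the candidate with maximum total Borda score, ties broken by choosing the least-indexed candidate among those with maximum score. Call an n-voter profile ≻^n manipulable if there exist rankings p and p′ such that the winner of the (n+1)-voter profile (≻^n, p′) is strictly preferred under p to the winner of (≻^n, p). Let M_m be the number of manipulable n-voter profiles on m candidates. Then lim_{m→∞} M_m / (m!)^n = 1; in particular, the Borda rule is not asymptotically strategy-proof on the number of candidates under the impartial culture assumption. -/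

import Mathlib

/-- The Borda score of candidate `c` in a profile of `n` rankings of `m` candidates, where a
ranking is a bijection from candidates to positions `Fin m` (position `0` most preferred)
and position `p` contributes score `m - 1 - p` (i.e. `m - (p+1)` in 1-based terms). -/
def bordaScore (m n : ℕ) (σ : Fin n → (Fin m ≃ Fin m)) (c : Fin m) : ℕ :=
  ∑ j, (m - 1 - ((σ j) c : ℕ))

/-- `w` is the Borda winner of the profile `σ`: it has maximum Borda score and is the
least-indexed candidate among those with maximum score. -/
def IsBordaWinner (m n : ℕ) (σ : Fin n → (Fin m ≃ Fin m)) (w : Fin m) : Prop :=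
  (∀ c : Fin m, bordaScore m n σ c ≤ bordaScore m n σ w) ∧
    (∀ c : Fin m, bordaScore m n σ c = bordaScore m n σ w → w ≤ c)

/-- The profile `σ` of `n` rankings is manipulable by one new voter: there are rankings
`p` (the true one) and `p'` such that the winner after appending `p'` is strictly preferred
under `p` (i.e. placed in a strictly smaller position by `p`) to the winner after
appending `p`. -/
def BordaManipulable (m n : ℕ) (σ : Fin n → (Fin m ≃ Fin m)) : Prop :=
  ∃ (p p' : Fin m ≃ Fin m) (w w' : Fin m),
    IsBordaWinner m (n + 1) (Fin.snoc σ p) w ∧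
    IsBordaWinner m (n + 1) (Fin.snoc σ p') w' ∧
    p w' < p w

/-- Total loss (sum of positions) of a candidate. -/
def bordaLoss (m n : ℕ) (σ : Fin n → (Fin m ≃ Fin m)) (c : Fin m) : ℕ :=
  ∑ j, ((σ j) c : ℕ)

lemma bordaScore_add_bordaLoss (m n : ℕ) (σ : Fin n → (Fin m ≃ Fin m)) (c : Fin m) :
    bordaScore m n σ c + bordaLoss m n σ c = n * (m - 1) := by
  unfold bordaScore bordaLoss
  rw [← Finset.sum_add_distrib]
  have : ∀ j ∈ (Finset.univ : Finset (Fin n)),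
      (m - 1 - ((σ j) c : ℕ)) + ((σ j) c : ℕ) = m - 1 := by
    intro j _
    have := ((σ j) c).isLt
    omega
  rw [Finset.sum_congr rfl this]
  simp

lemma bordaLoss_snoc (m n : ℕ) (σ : Fin n → (Fin m ≃ Fin m)) (p : Fin m ≃ Fin m) (c : Fin m) :
    bordaLoss m (n + 1) (Fin.snoc σ p) c = bordaLoss m n σ c + (p c : ℕ) := by
  unfold bordaLoss
  rw [Fin.sum_univ_castSucc]
  simp

lemma isBordaWinner_of_loss (m n : ℕ) (σ : Fin n → (Fin m ≃ Fin m)) (p : Fin m ≃ Fin m)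
    (w : Fin m)
    (h : ∀ c, c ≠ w → bordaLoss m n σ w + (p w : ℕ) < bordaLoss m n σ c + (p c : ℕ)) :
    IsBordaWinner m (n + 1) (Fin.snoc σ p) w := by
  have key : ∀ c, bordaScore m (n + 1) (Fin.snoc σ p) c + (bordaLoss m n σ c + (p c : ℕ))
      = (n + 1) * (m - 1) := by
    intro c
    rw [← bordaLoss_snoc]
    exact bordaScore_add_bordaLoss _ _ _ _
  refine ⟨fun c => ?_, fun c hc => ?_⟩
  · by_cases hcw : c = w
    · rw [hcw]
    · have h1 := key c
      have h2 := key w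
      have h3 := h c hcw
      omega
  · by_cases hcw : c = w
    · rw [hcw]
    · have h1 := key c
      have h2 := key w
      have h3 := h c hcw
      omega

/-- A ranking putting `e` first and the set `S` last. -/
lemma exists_ranking (m : ℕ) (S : Finset (Fin m)) (e : Fin m) (he : e ∉ S) :
    ∃ p : Fin m ≃ Fin m, (p e : ℕ) = 0 ∧ ∀ c ∈ S, m - S.card ≤ (p c : ℕ) := by
  have hm : 0 < m := e.pos
  have hk : S.card ≤ m := by simpa using Finset.card_le_univ S
  have hcard : Fintype.card {x // x ∈ S} = Fintype.card {y : Fin m // m - S.card ≤ (y : ℕ)} := by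
    rw [Fintype.card_coe, Fintype.card_subtype]
    have h := Finset.card_filter_add_card_filter_not (s := (Finset.univ : Finset (Fin m)))
      (fun y : Fin m => m - S.card ≤ (y : ℕ))
    have h2 : (Finset.univ.filter (fun y : Fin m => ¬ m - S.card ≤ (y : ℕ))).card
        = m - S.card := by
      simp only [not_le]
      rw [Fin.card_filter_val_lt]
      omega
    rw [h2] at h
    simp only [Finset.card_univ, Fintype.card_fin] at h
    omega
  let f := Fintype.equivOfCardEq hcard
  let g : Fin m ≃ Fin m := f.extendSubtype
  have hg1 : ∀ c ∈ S, m - S.card ≤ (g c : ℕ) := fun c hc => f.extendSubtype_mem c hc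
  have hg2 : ¬ m - S.card ≤ (g e : ℕ) := f.extendSubtype_not_mem e he
  refine ⟨g.trans (Equiv.swap (g e) ⟨0, hm⟩), by simp, fun c hc => ?_⟩
  have h1 := hg1 c hc
  rw [Equiv.trans_apply, Equiv.swap_apply_of_ne_of_ne]
  · exact h1
  · intro h
    rw [h] at h1
    exact hg2 h1
  · intro h
    rw [h] at h1
    simp only at h1
    omega

lemma manipulable_of_gap (m n : ℕ) (hn : 1 ≤ n) (σ : Fin n → (Fin m ≃ Fin m)) (c₁ c₂ : Fin m)
    (h12 : bordaLoss m n σ c₁ + 2 ≤ bordaLoss m n σ c₂)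
    (h2 : 2 * bordaLoss m n σ c₂ + 2 < m) : BordaManipulable m n σ := by
  classical
  have : Nonempty (Fin m) := ⟨c₁⟩
  set L := bordaLoss m n σ with hL
  obtain ⟨a, ha⟩ := Finite.exists_min L
  let T : Finset (Fin m) := Finset.univ.filter (fun c => L a + 2 ≤ L c)
  have hT : T.Nonempty := ⟨c₂, by
    have := ha c₁
    simp only [T, Finset.mem_filter, Finset.mem_univ, true_and]; omega⟩
  obtain ⟨e, heT, he⟩ := T.exists_min_image L hT
  have he2 : L e ≤ L c₂ := he c₂ (by
    have := ha c₁
    simp only [T, Finset.mem_filter, Finset.mem_univ, true_and]; omega)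
  have hea : L a + 2 ≤ L e := by simpa [T] using heT
  let S : Finset (Fin m) := Finset.univ.filter (fun c => L c < L a + 2)
  have hS : ∀ c, c ∈ S ↔ L c < L a + 2 := by simp [S]
  have heS : e ∉ S := by rw [hS]; omega
  have haS : a ∈ S := by rw [hS]; omega
  have hnS : ∀ c, c ∉ S → L e ≤ L c := by
    intro c hc
    rw [hS] at hc
    exact he c (by simp only [T, Finset.mem_filter, Finset.mem_univ, true_and]; omega)
  have hScard : S.card ≤ L a + 2 := by
    have : S.card ≤ (Finset.range (L a + 2)).card := by
      apply Finset.card_le_card_of_injOn (fun c => ((σ ⟨0, hn⟩) c : ℕ))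
      · intro c hc
        have hc' := (hS c).1 hc
        have : ((σ ⟨0, hn⟩) c : ℕ) ≤ L c := by
          rw [hL]
          exact Finset.single_le_sum (f := fun j => ((σ j) c : ℕ)) (fun _ _ => Nat.zero_le _)
            (Finset.mem_univ _)
        simp only [Finset.coe_range, Set.mem_Iio]
        omega
      · intro x _ y _ hxy
        exact (σ ⟨0, hn⟩).injective (Fin.ext hxy)
    simpa using this
  obtain ⟨p, hpe, hpS⟩ := exists_ranking m S e heS
  have hd : L e - L a - 1 < m := by omega
  have hpos : ∀ (q : Fin m ≃ Fin m), (q e : ℕ) = 0 → ∀ c, c ≠ e → 0 < (q c : ℕ) := by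
    intro q hq c hc
    rcases Nat.eq_zero_or_pos (q c : ℕ) with h | h
    · exact absurd (q.injective (Fin.ext (h.trans hq.symm))) hc
    · exact h
  have hpa := hpS a haS
  let q : Fin m ≃ Fin m := p.trans (Equiv.swap (p a) ⟨L e - L a - 1, hd⟩)
  have hqa : (q a : ℕ) = L e - L a - 1 := by simp [q]
  have hqe : (q e : ℕ) = 0 := by
    simp only [q]
    rw [Equiv.trans_apply, Equiv.swap_apply_of_ne_of_ne, hpe]
    · intro h
      rw [h] at hpe
      omega
    · intro h
      rw [h] at hpe
      simp only at hpe
      omega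
  have hqS : ∀ c ∈ S, c ≠ a → m - S.card ≤ (q c : ℕ) := by
    intro c hc hca
    have h1 := hpS c hc
    simp only [q]
    rw [Equiv.trans_apply, Equiv.swap_apply_of_ne_of_ne]
    · exact h1
    · intro h
      exact hca (p.injective h)
    · intro h
      rw [h] at h1
      simp only at h1
      omega
  refine ⟨q, p, a, e, isBordaWinner_of_loss m n σ q a ?_, isBordaWinner_of_loss m n σ p e ?_, ?_⟩
  · intro c hca
    rw [← hL, hqa]
    by_cases hcS : c ∈ S
    · have := hqS c hcS hca
      have := ha c
      omega
    · have := hnS c hcS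
      omega
  · intro c hce
    rw [← hL, hpe]
    by_cases hcS : c ∈ S
    · have := hpS c hcS
      have := ha c
      omega
    · have := hnS c hcS
      have := hpos p hpe c hce
      omega
  · rw [Fin.lt_def, hqe, hqa]
    omega

open Finset in
/-- single-candidate count -/
lemma count_one (m : ℕ) (A : Finset (Fin m)) (c : Fin m) :
    (m : ℝ) * ∑ τ : Equiv.Perm (Fin m), (if τ c ∈ A then (1 : ℝ) else 0)
      = (A.card : ℝ) * (m.factorial : ℝ) := by
  have h1 : ∀ c' : Fin m, ∑ τ : Equiv.Perm (Fin m), (if τ c' ∈ A then (1 : ℝ) else 0)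
      = ∑ τ : Equiv.Perm (Fin m), (if τ c ∈ A then (1 : ℝ) else 0) := by
    intro c'
    refine Fintype.sum_equiv (Equiv.mulRight (Equiv.swap c c')) _ _ (fun τ => ?_)
    simp
  have h2 : ∑ c' : Fin m, ∑ τ : Equiv.Perm (Fin m), (if τ c' ∈ A then (1 : ℝ) else 0)
      = (A.card : ℝ) * (m.factorial : ℝ) := by
    rw [Finset.sum_comm]
    have : ∀ τ : Equiv.Perm (Fin m), ∑ c' : Fin m, (if τ c' ∈ A then (1 : ℝ) else 0)
        = A.card := by
      intro τ
      rw [Equiv.sum_comp τ (fun x => if x ∈ A then (1 : ℝ) else 0)]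
      simp
    simp only [this]
    simp [Fintype.card_perm, mul_comm]
  rw [← h2, Finset.sum_congr rfl (fun c' _ => h1 c')]
  simp

/-- two-candidate count -/
lemma count_two (m : ℕ) (A : Finset (Fin m)) (c d : Fin m) (hcd : c ≠ d) :
    (m : ℝ) * ((m : ℝ) - 1) * ∑ τ : Equiv.Perm (Fin m),
      ((if τ c ∈ A then (1 : ℝ) else 0) * (if τ d ∈ A then (1 : ℝ) else 0))
      = (A.card : ℝ) * ((A.card : ℝ) - 1) * (m.factorial : ℝ) := by
  have h1 : ∀ d' : Fin m, d' ≠ c → ∑ τ : Equiv.Perm (Fin m),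
      ((if τ c ∈ A then (1 : ℝ) else 0) * (if τ d' ∈ A then (1 : ℝ) else 0))
      = ∑ τ : Equiv.Perm (Fin m),
      ((if τ c ∈ A then (1 : ℝ) else 0) * (if τ d ∈ A then (1 : ℝ) else 0)) := by
    intro d' hd'
    refine Fintype.sum_equiv (Equiv.mulRight (Equiv.swap d d')) _ _ (fun τ => ?_)
    simp [Equiv.swap_apply_of_ne_of_ne hcd hd'.symm]
  have h2 : ∑ d' : Fin m, ∑ τ : Equiv.Perm (Fin m),
      ((if τ c ∈ A then (1 : ℝ) else 0) * (if τ d' ∈ A then (1 : ℝ) else 0))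
      = (A.card : ℝ) * ∑ τ : Equiv.Perm (Fin m), (if τ c ∈ A then (1 : ℝ) else 0) := by
    rw [Finset.sum_comm, Finset.mul_sum]
    refine Finset.sum_congr rfl (fun τ _ => ?_)
    rw [← Finset.mul_sum, Equiv.sum_comp τ (fun x => if x ∈ A then (1 : ℝ) else 0)]
    simp
  rw [← Finset.add_sum_erase _ _ (Finset.mem_univ c),
    Finset.sum_congr rfl (fun d' hd' => h1 d' (Finset.ne_of_mem_erase hd'))] at h2
  have hm : 1 ≤ m := c.pos
  have h3 : ∑ τ : Equiv.Perm (Fin m),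
      ((if τ c ∈ A then (1 : ℝ) else 0) * (if τ c ∈ A then (1 : ℝ) else 0))
      = ∑ τ : Equiv.Perm (Fin m), (if τ c ∈ A then (1 : ℝ) else 0) := by
    refine Finset.sum_congr rfl (fun τ _ => ?_)
    split_ifs <;> simp
  rw [h3, Finset.sum_const, Finset.card_erase_of_mem (Finset.mem_univ c), Finset.card_univ,
    Fintype.card_fin, nsmul_eq_mul, Nat.cast_sub hm] at h2
  have h4 := count_one m A c
  push_cast at h2
  linear_combination (m : ℝ) * h2 + ((A.card : ℝ) - 1) * h4

/-- second-moment bound -/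
lemma bad_bound (m n : ℕ) (hm : 2 ≤ m) (A : Finset (Fin m)) (hA : 0 < A.card) :
    ((Finset.univ.filter (fun σ : Fin n → Equiv.Perm (Fin m) =>
      ¬ ∃ c, ∀ j, σ j c ∈ A)).card : ℝ) * ((m : ℝ) * ((A.card : ℝ) / m) ^ n)
      ≤ (m.factorial : ℝ) ^ n := by
  classical
  set F : ℝ := (m.factorial : ℝ) with hF
  set ρ : ℝ := (A.card : ℝ) / m with hρ
  set μ : ℝ := (m : ℝ) * ρ ^ n with hμ
  have hm0 : (0 : ℝ) < m := by positivity
  have hm2 : (2 : ℝ) ≤ m := by exact_mod_cast hm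
  have hA0 : (0 : ℝ) < A.card := by exact_mod_cast hA
  have hAm : (A.card : ℝ) ≤ m := by
    have : A.card ≤ m := by simpa using Finset.card_le_univ A
    exact_mod_cast this
  have hρ0 : 0 < ρ := by positivity
  have hμ0 : 0 < μ := by positivity
  have hF0 : 0 < F := by positivity
  let I : Fin m → Equiv.Perm (Fin m) → ℝ := fun c τ => if τ c ∈ A then 1 else 0
  have N1 : ∀ c, ∑ τ, I c τ = ρ * F := by
    intro c
    have := count_one m A c
    rw [hρ]
    field_simp
    linarith
  have N2 : ∀ c d, c ≠ d → ∑ τ, I c τ * I d τ ≤ ρ ^ 2 * F := by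
    intro c d hcd
    have h := count_two m A c d hcd
    have h' : ∑ τ, I c τ * I d τ = (A.card : ℝ) * ((A.card : ℝ) - 1) * F / (m * (m - 1)) := by
      rw [eq_div_iff (by nlinarith)]
      linarith
    rw [h', hρ, div_pow, div_mul_eq_mul_div]
    rw [div_le_div_iff₀ (by nlinarith) (by positivity)]
    have : (A.card : ℝ) * F * m * ((A.card - 1) * m) ≤ A.card * F * m * (A.card * (m - 1)) := by
      apply mul_le_mul_of_nonneg_left _ (by positivity)
      nlinarith
    nlinarith
  let X : (Fin n → Equiv.Perm (Fin m)) → ℝ := fun σ => ∑ c, ∏ j, I c (σ j)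
  have E1 : ∑ σ, X σ = μ * F ^ n := by
    simp only [X]
    rw [Finset.sum_comm]
    have : ∀ c, ∑ σ : Fin n → Equiv.Perm (Fin m), ∏ j, I c (σ j) = (ρ * F) ^ n := by
      intro c
      rw [← N1 c, Fintype.sum_pow]
    simp only [this]
    simp [hμ]
    ring
  have E2 : ∑ σ, X σ ^ 2 ≤ μ * F ^ n + μ ^ 2 * F ^ n := by
    have h : ∀ σ, X σ ^ 2 = ∑ c, ∑ d, ∏ j, (I c (σ j) * I d (σ j)) := by
      intro σ
      simp only [X, sq, Finset.sum_mul_sum, Finset.prod_mul_distrib]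
    simp only [h]
    rw [Finset.sum_comm]
    have h2 : ∀ c, ∑ σ : Fin n → Equiv.Perm (Fin m), ∑ d, ∏ j, (I c (σ j) * I d (σ j))
        ≤ (ρ * F) ^ n + m * (ρ ^ 2 * F) ^ n := by
      intro c
      rw [Finset.sum_comm]
      have h3 : ∀ d, ∑ σ : Fin n → Equiv.Perm (Fin m), ∏ j, (I c (σ j) * I d (σ j))
          ≤ (if d = c then (ρ * F) ^ n else 0) + (ρ ^ 2 * F) ^ n := by
        intro d
        have h4 : ∑ σ : Fin n → Equiv.Perm (Fin m), ∏ j, (I c (σ j) * I d (σ j))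
          = (∑ τ, I c τ * I d τ) ^ n := by
          rw [Fintype.sum_pow]
        rw [h4]
        split_ifs with hdc
        · subst hdc
          have : ∑ τ, I d τ * I d τ = ρ * F := by
            rw [← N1 d]
            refine Finset.sum_congr rfl (fun τ _ => ?_)
            simp only [I]
            split_ifs <;> simp
          rw [this]
          have : 0 ≤ (ρ ^ 2 * F) ^ n := by positivity
          linarith
        · rw [zero_add]
          apply pow_le_pow_left₀ _ (N2 c d (Ne.symm hdc))
          apply Finset.sum_nonneg
          intro τ _
          simp only [I]
          split_ifs <;> simp
      refine (Finset.sum_le_sum (fun d _ => h3 d)).trans (le_of_eq ?_)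
      rw [Finset.sum_add_distrib]
      simp
    refine (Finset.sum_le_sum (fun c _ => h2 c)).trans (le_of_eq ?_)
    simp [hμ]
    ring
  have E3 : ∑ σ : Fin n → Equiv.Perm (Fin m), (X σ - μ) ^ 2 ≤ μ * F ^ n := by
    have h : ∑ σ : Fin n → Equiv.Perm (Fin m), (X σ - μ) ^ 2
        = ∑ σ, X σ ^ 2 - 2 * μ * ∑ σ, X σ + μ ^ 2 * F ^ n := by
      have h5 : ∑ _σ : Fin n → Equiv.Perm (Fin m), μ ^ 2 = μ ^ 2 * F ^ n := by
        simp [Fintype.card_perm, hF, mul_comm]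
      rw [← h5, Finset.mul_sum, ← Finset.sum_sub_distrib, ← Finset.sum_add_distrib]
      refine Finset.sum_congr rfl (fun σ _ => ?_)
      ring
    rw [h, E1]
    nlinarith
  set B := Finset.univ.filter (fun σ : Fin n → Equiv.Perm (Fin m) => ¬ ∃ c, ∀ j, σ j c ∈ A)
    with hB
  have E4 : (B.card : ℝ) * μ ^ 2 ≤ ∑ σ : Fin n → Equiv.Perm (Fin m), (X σ - μ) ^ 2 := by
    have h : ∑ σ ∈ B, (X σ - μ) ^ 2 ≤ ∑ σ : Fin n → Equiv.Perm (Fin m), (X σ - μ) ^ 2 :=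
      Finset.sum_le_sum_of_subset_of_nonneg (Finset.subset_univ _) (fun _ _ _ => sq_nonneg _)
    refine le_trans (le_of_eq ?_) h
    have h6 : ∀ σ ∈ B, (X σ - μ) ^ 2 = μ ^ 2 := by
      intro σ hσ
      have hσ' : ¬ ∃ c, ∀ j, σ j c ∈ A := by simpa [hB] using hσ
      push Not at hσ'
      have : X σ = 0 := by
        apply Finset.sum_eq_zero
        intro c _
        obtain ⟨j, hj⟩ := hσ' c
        apply Finset.prod_eq_zero (Finset.mem_univ j)
        simp [I, hj]
      rw [this]
      ring
    rw [Finset.sum_congr rfl h6]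
    simp
  have E5 : μ * ((B.card : ℝ) * μ) ≤ μ * F ^ n := by nlinarith
  exact le_of_mul_le_mul_left E5 hμ0

lemma manipulable_of_good (m n q : ℕ) (hn : 1 ≤ n) (hq : 2 ≤ q) (hqm : 16 * n * q ≤ m)
    (σ : Fin n → (Fin m ≃ Fin m))
    (h1 : ∃ c, ∀ j, ((σ j) c : ℕ) < q)
    (h2 : ∃ c, ∀ j, 2 * q ≤ ((σ j) c : ℕ) ∧ ((σ j) c : ℕ) < 3 * q) :
    BordaManipulable m n σ := by
  obtain ⟨c₁, hc₁⟩ := h1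
  obtain ⟨c₂, hc₂⟩ := h2
  have a1 : bordaLoss m n σ c₁ ≤ n * q := by
    have := Finset.sum_le_card_nsmul Finset.univ (fun j => ((σ j) c₁ : ℕ)) q
      (fun j _ => (hc₁ j).le)
    simpa [bordaLoss] using this
  have a2 : bordaLoss m n σ c₂ ≤ n * (3 * q) := by
    have := Finset.sum_le_card_nsmul Finset.univ (fun j => ((σ j) c₂ : ℕ)) (3 * q)
      (fun j _ => (hc₂ j).2.le)
    simpa [bordaLoss] using this
  have a3 : n * (2 * q) ≤ bordaLoss m n σ c₂ := by
    have := Finset.card_nsmul_le_sum Finset.univ (fun j => ((σ j) c₂ : ℕ)) (2 * q)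
      (fun j _ => (hc₂ j).1)
    simpa [bordaLoss] using this
  have a4 : 2 ≤ n * q := by nlinarith
  exact manipulable_of_gap m n hn σ c₁ c₂ (by nlinarith) (by nlinarith)

lemma fraction_lower (n m : ℕ) (hn : 1 ≤ n) (hm : 32 * n ≤ m) :
    1 - 2 * (32 * (n : ℝ)) ^ n / m ≤
      (Nat.card {σ : Fin n → (Fin m ≃ Fin m) // BordaManipulable m n σ} : ℝ) /
          ((Nat.factorial m : ℝ) ^ n) := by
  classical
  set q := m / (16 * n) with hq
  have hn16 : 0 < 16 * n := by omega
  have hq2 : 2 ≤ q := by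
    rw [hq, Nat.le_div_iff_mul_le hn16]; omega
  have hqm : 16 * n * q ≤ m := Nat.mul_div_le m (16 * n)
  have hqm' : m ≤ 32 * n * q := by
    have := Nat.lt_mul_div_succ m hn16
    rw [← hq] at this
    nlinarith
  have hqm3 : 3 * q ≤ m := by nlinarith
  let A₁ : Finset (Fin m) := Finset.univ.filter (fun x => (x : ℕ) < q)
  let A₂ : Finset (Fin m) := Finset.univ.filter (fun x => 2 * q ≤ (x : ℕ) ∧ (x : ℕ) < 3 * q)
  have hA₁ : A₁.card = q := by
    simp only [A₁]
    rw [Fin.card_filter_val_lt]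
    omega
  have hA₂ : A₂.card = q := by
    have h : A₂.map Fin.valEmbedding = Finset.Ico (2 * q) (3 * q) := by
      ext x
      simp only [A₂, Finset.mem_map, Finset.mem_filter, Finset.mem_univ, true_and,
        Fin.valEmbedding_apply, Finset.mem_Ico]
      constructor
      · rintro ⟨y, hy, rfl⟩
        exact hy
      · intro hx
        exact ⟨⟨x, by omega⟩, hx, rfl⟩
    rw [← Finset.card_map, h, Nat.card_Ico]
    omega
  let B : Finset (Fin m) → Finset (Fin n → Equiv.Perm (Fin m)) := fun A =>
    Finset.univ.filter (fun σ => ¬ ∃ c, ∀ j, σ j c ∈ A)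
  let G : Finset (Fin n → Equiv.Perm (Fin m)) :=
    Finset.univ.filter (fun σ => BordaManipulable m n σ)
  have hcard : Nat.card {σ : Fin n → (Fin m ≃ Fin m) // BordaManipulable m n σ} = G.card := by
    rw [Nat.card_eq_fintype_card, Fintype.card_subtype]
  have hcover : (Finset.univ : Finset (Fin n → Equiv.Perm (Fin m))) ⊆ (B A₁ ∪ B A₂) ∪ G := by
    intro σ _
    by_contra hcon
    simp only [Finset.mem_union, B, G, Finset.mem_filter, Finset.mem_univ, true_and,
      not_or, not_not, A₁, A₂] at hcon
    exact hcon.2 (manipulable_of_good m n q hn hq2 hqm σ hcon.1.1 hcon.1.2)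
  have hsum : m.factorial ^ n ≤ (B A₁).card + (B A₂).card + G.card := by
    have h1 := Finset.card_le_card hcover
    have h2 := Finset.card_union_le (B A₁ ∪ B A₂) G
    have h3 := Finset.card_union_le (B A₁) (B A₂)
    have h4 : (Finset.univ : Finset (Fin n → Equiv.Perm (Fin m))).card = m.factorial ^ n := by
      simp [Fintype.card_perm]
    omega
  have hm0 : (0 : ℝ) < m := by
    have : 0 < m := by omega
    exact_mod_cast this
  have hn0 : (0 : ℝ) < n := by exact_mod_cast hn
  set F : ℝ := (m.factorial : ℝ) ^ n with hF
  have hF0 : 0 < F := by positivity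
  have hbad : ∀ A : Finset (Fin m), A.card = q →
      ((B A).card : ℝ) ≤ (32 * (n : ℝ)) ^ n / m * F := by
    intro A hA
    have h := bad_bound m n (by omega) A (by omega)
    rw [hA] at h
    have hr : 1 / (32 * (n : ℝ)) ≤ (q : ℝ) / m := by
      rw [div_le_div_iff₀ (by positivity) hm0]
      have : (m : ℝ) ≤ 32 * n * q := by exact_mod_cast hqm'
      linarith
    have hr' : (1 / (32 * (n : ℝ))) ^ n ≤ ((q : ℝ) / m) ^ n :=
      pow_le_pow_left₀ (by positivity) hr n
    have h5 : ((B A).card : ℝ) * (m * (1 / (32 * (n : ℝ))) ^ n) ≤ F := by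
      refine le_trans ?_ h
      gcongr
    rw [div_pow, one_pow] at h5
    have hP : 0 < (32 * (n : ℝ)) ^ n := by positivity
    rw [div_mul_eq_mul_div, le_div_iff₀ hm0]
    rw [mul_one_div, ← mul_div_assoc, div_le_iff₀ hP] at h5
    linarith
  rw [hcard, le_div_iff₀ hF0]
  have b1 := hbad A₁ hA₁
  have b2 := hbad A₂ hA₂
  have hsum' : F ≤ ((B A₁).card : ℝ) + (B A₂).card + G.card := by
    rw [hF]; exact_mod_cast hsum
  have : (1 - 2 * (32 * (n : ℝ)) ^ n / m) * F = F - 2 * ((32 * (n : ℝ)) ^ n / m * F) := by ring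
  rw [this]
  linarith

/-- For fixed `n ≥ 1`, the fraction of `n`-voter Borda profiles on `m`
candidates that are manipulable by a single new voter tends to `1` as `m → ∞`; i.e. Borda is
not asymptotically strategy-proof on the number of candidates under impartial culture. -/
theorem borda_not_asymptotically_strategy_proof (n : ℕ) (hn : 1 ≤ n) :
    Filter.Tendsto
      (fun m : ℕ =>
        (Nat.card {σ : Fin n → (Fin m ≃ Fin m) // BordaManipulable m n σ} : ℝ) /
          ((Nat.factorial m : ℝ) ^ n))
      Filter.atTop (nhds 1) := by
  have hlow : Filter.Tendsto (fun m : ℕ => 1 - 2 * (32 * (n : ℝ)) ^ n / (m : ℝ))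
      Filter.atTop (nhds 1) := by
    have h := tendsto_const_div_atTop_nhds_zero_nat (2 * (32 * (n : ℝ)) ^ n)
    simpa using h.const_sub 1
  refine tendsto_of_tendsto_of_tendsto_of_le_of_le' hlow tendsto_const_nhds ?_ ?_
  · filter_upwards [Filter.eventually_ge_atTop (32 * n)] with m hm
    exact fraction_lower n m hn hm
  · filter_upwards with m
    rw [div_le_one (by positivity)]
    have h := Nat.card_le_card_of_injective
      (Subtype.val : {σ : Fin n → (Fin m ≃ Fin m) // BordaManipulable m n σ} → _)
      Subtype.val_injective
    have h2 : Nat.card (Fin n → (Fin m ≃ Fin m)) = m.factorial ^ n := by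
      rw [Nat.card_eq_fintype_card]
      have : Fintype.card (Fin m ≃ Fin m) = m.factorial := by
        simpa using Fintype.card_perm (α := Fin m)
      simp [this]
    rw [h2] at h
    exact_mod_cast h
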